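/- Let 0 < r ≤ 1/3. As m → ∞, the distinguished points of the caustic of the odd iterate R_r^{2m+1} converge to the corresponding points of the unit circle: (a) y_{2m+1}(0) = 0 for all m and x_{2m+1}(0) → −1; (b) y_{2m+1}(π) = 0 for all m and x_{2m+1}(π) → 1; (c) x_{2m+1}(φ_c) = cos φ_c for all m and y_{2m+1}(φ_c) → sin φ_c. -/

import Mathlib

open Real Filter

/-- The reflection map of the unit circle with light source at `(r,0)`. -/
noncomputable def R (r : ℝ) (φ : ℝ) : ℝ :=
  φ + π - 2 * arctan (r * sin φ / (1 - r * cos φ))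

/-- The angle `φ_c ∈ (0,π)` with `cos φ_c = (1 − √(1+8r²))/(4r)`. -/
noncomputable def φc (r : ℝ) : ℝ :=
  arccos ((1 - Real.sqrt (1 + 8 * r ^ 2)) / (4 * r))

/-- `x`-coordinate of the caustic of `R_r^n`. -/
noncomputable def xc (r : ℝ) (n : ℕ) (φ : ℝ) : ℝ :=
  (deriv ((R r)^[n]) φ * cos φ + cos ((R r)^[n] φ)) / (1 + deriv ((R r)^[n]) φ)

/-- `y`-coordinate of the caustic of `R_r^n`. -/
noncomputable def yc (r : ℝ) (n : ℕ) (φ : ℝ) : ℝ :=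
  (deriv ((R r)^[n]) φ * sin φ + sin ((R r)^[n] φ)) / (1 + deriv ((R r)^[n]) φ)

/-- The quantity `A_n(φ) = −(R_r^n)'(φ) + ((R_r^n)'(φ))³ + 2 (R_r^n)'''(φ)`. -/
noncomputable def A (r : ℝ) (n : ℕ) (φ : ℝ) : ℝ :=
  -(deriv ((R r)^[n]) φ) + (deriv ((R r)^[n]) φ) ^ 3 + 2 * iteratedDeriv 3 ((R r)^[n]) φ

/-- The derivative of the reflection map, as a function of the angle. -/
noncomputable def reflectionDeriv (r φ : ℝ) : ℝ :=
  (1 + 3 * r ^ 2 - 4 * r * cos φ) / (1 - 2 * r * cos φ + r ^ 2)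

lemma one_sub_mul_cos_pos {r : ℝ} (hr : 0 < r) (hr1 : r < 1) (φ : ℝ) : 0 < 1 - r * cos φ := by
  nlinarith [cos_le_one φ]

lemma hasDerivAt_R {r : ℝ} (hr : 0 < r) (hr1 : r < 1) (φ : ℝ) :
    HasDerivAt (R r) (reflectionDeriv r φ) φ := by
  have h1 := one_sub_mul_cos_pos hr hr1 φ
  have hsq := sin_sq_add_cos_sq φ
  have h2 : 0 < 1 - 2 * r * cos φ + r ^ 2 := by
    nlinarith [sq_nonneg (r * sin φ), pow_pos h1 2]
  have hq := (((hasDerivAt_sin φ).const_mul r).div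
    (((hasDerivAt_cos φ).const_mul r).const_sub 1) h1.ne').arctan
  have h := ((hasDerivAt_id φ).add_const π).sub (hq.const_mul 2)
  refine h.congr_deriv ?_
  have h3 : 1 + (r * sin φ / (1 - r * cos φ)) ^ 2
      = (1 - 2 * r * cos φ + r ^ 2) / (1 - r * cos φ) ^ 2 := by
    field_simp
    linear_combination r ^ 2 * hsq
  simp only [Pi.div_apply, reflectionDeriv]
  rw [h3]
  field_simp
  linear_combination 2 * r ^ 2 * hsq

lemma R_add_nat_mul_two_pi (r φ : ℝ) (m : ℕ) :
    R r (φ + m * (2 * π)) = R r φ + m * (2 * π) := by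
  simp only [R, sin_add_nat_mul_two_pi, cos_add_nat_mul_two_pi]
  ring

lemma R_neg (r φ : ℝ) : R r (-φ) = 2 * π - R r φ := by
  simp only [R, sin_neg, cos_neg, mul_neg, neg_div, arctan_neg]
  ring

lemma reflectionDeriv_add_nat_mul_two_pi (r φ : ℝ) (m : ℕ) :
    reflectionDeriv r (φ + m * (2 * π)) = reflectionDeriv r φ := by
  simp only [reflectionDeriv, cos_add_nat_mul_two_pi]

/-- Odd iterates of the reflection map, and their derivatives, along an orbit which has period two
modulo `2π`. -/
lemma iterate_odd_of_two_cycle {r a b : ℝ} (hr : 0 < r) (hr1 : r < 1)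
    (hab : R r a = b) (hba : R r b = a + 2 * π) (m : ℕ) :
    (R r)^[2 * m + 1] a = b + m * (2 * π) ∧
      HasDerivAt ((R r)^[2 * m + 1])
        (reflectionDeriv r a ^ (m + 1) * reflectionDeriv r b ^ m) a := by
  induction m with
  | zero => simpa [hab] using hasDerivAt_R hr hr1 a
  | succ m ih =>
    obtain ⟨hv, hd⟩ := ih
    have e : (R r)^[2 * (m + 1) + 1] = R r ∘ R r ∘ (R r)^[2 * m + 1] := by
      rw [show 2 * (m + 1) + 1 = (2 * m + 1) + 1 + 1 by ring, Function.iterate_succ',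
        Function.iterate_succ']
    have hb : R r (b + m * (2 * π)) = a + (m + 1 : ℕ) * (2 * π) := by
      rw [R_add_nat_mul_two_pi, hba]
      push_cast
      ring
    rw [e]
    refine ⟨?_, ?_⟩
    · simp only [Function.comp_apply]
      rw [hv, hb, R_add_nat_mul_two_pi, hab]
    · have h1 : HasDerivAt (R r ∘ (R r)^[2 * m + 1]) _ a :=
        HasDerivAt.comp a (hasDerivAt_R hr hr1 _) hd
      have h2 : HasDerivAt (R r ∘ R r ∘ (R r)^[2 * m + 1]) _ a :=
        HasDerivAt.comp a (hasDerivAt_R hr hr1 _) h1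
      refine h2.congr_deriv ?_
      simp only [Function.comp_apply]
      rw [hv, hb, reflectionDeriv_add_nat_mul_two_pi, reflectionDeriv_add_nat_mul_two_pi]
      ring

lemma xc_odd_of_two_cycle {r a b : ℝ} (hr : 0 < r) (hr1 : r < 1)
    (hab : R r a = b) (hba : R r b = a + 2 * π) (m : ℕ) :
    xc r (2 * m + 1) a =
      (reflectionDeriv r a ^ (m + 1) * reflectionDeriv r b ^ m * cos a + cos b) /
        (1 + reflectionDeriv r a ^ (m + 1) * reflectionDeriv r b ^ m) := by
  obtain ⟨hv, hd⟩ := iterate_odd_of_two_cycle hr hr1 hab hba m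
  rw [xc, hd.deriv, hv, cos_add_nat_mul_two_pi]

lemma yc_odd_of_two_cycle {r a b : ℝ} (hr : 0 < r) (hr1 : r < 1)
    (hab : R r a = b) (hba : R r b = a + 2 * π) (m : ℕ) :
    yc r (2 * m + 1) a =
      (reflectionDeriv r a ^ (m + 1) * reflectionDeriv r b ^ m * sin a + sin b) /
        (1 + reflectionDeriv r a ^ (m + 1) * reflectionDeriv r b ^ m) := by
  obtain ⟨hv, hd⟩ := iterate_odd_of_two_cycle hr hr1 hab hba m
  rw [yc, hd.deriv, hv, sin_add_nat_mul_two_pi]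

/-- The caustic point tends to the image point on an attracting two-cycle. -/
lemma tendsto_xc_odd_of_two_cycle {r a b : ℝ} (hr : 0 < r) (hr1 : r < 1)
    (hab : R r a = b) (hba : R r b = a + 2 * π)
    (hD : |reflectionDeriv r a * reflectionDeriv r b| < 1) :
    Tendsto (fun m : ℕ => xc r (2 * m + 1) a) atTop (nhds (cos b)) := by
  have h0 : Tendsto (fun m : ℕ => reflectionDeriv r a ^ (m + 1) * reflectionDeriv r b ^ m)
      atTop (nhds 0) := by
    have h := (tendsto_pow_atTop_nhds_zero_of_abs_lt_one hD).const_mul (reflectionDeriv r a)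
    rw [mul_zero] at h
    refine h.congr fun m => ?_
    rw [mul_pow]
    ring
  have h1 := ((h0.mul_const (cos a)).add_const (cos b)).div (h0.const_add 1) (by norm_num)
  simp only [zero_mul, zero_add, add_zero, div_one] at h1
  exact h1.congr fun m => (xc_odd_of_two_cycle hr hr1 hab hba m).symm

lemma R_zero (r : ℝ) : R r 0 = π := by simp [R]

lemma R_pi (r : ℝ) : R r π = 2 * π := by
  simp [R]
  ring

lemma R_two_pi (r : ℝ) : R r (2 * π) = π + 2 * π := by
  simpa [R_zero] using R_add_nat_mul_two_pi r 0 1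

lemma abs_reflectionDeriv_zero_mul_pi_lt_one {r : ℝ} (hr : 0 < r) (hr1 : r ≤ 1 / 3) :
    |reflectionDeriv r 0 * reflectionDeriv r π| < 1 := by
  have h1 : 0 < 1 - r := by linarith
  have h2 : 0 < 1 + r := by linarith
  have e : reflectionDeriv r 0 * reflectionDeriv r π
      = (1 - 3 * r) * (1 + 3 * r) / ((1 - r) * (1 + r)) := by
    have e1 : 1 - 2 * r + r ^ 2 = (1 - r) ^ 2 := by ring
    have e2 : 1 + 2 * r + r ^ 2 = (1 + r) ^ 2 := by ring
    simp only [reflectionDeriv, cos_zero, cos_pi, mul_one, mul_neg, sub_neg_eq_add, e1, e2]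
    field_simp
    ring
  rw [e, abs_of_nonneg (div_nonneg (mul_nonneg (by linarith) (by linarith)) (by positivity)),
    div_lt_one (by positivity)]
  nlinarith

lemma cos_φc_spec {r : ℝ} (hr : 0 < r) (hr1 : r < 1) :
    2 * r * cos (φc r) ^ 2 - cos (φc r) - r = 0 ∧ -1 < cos (φc r) ∧ cos (φc r) < 0 := by
  have hs : √(1 + 8 * r ^ 2) ^ 2 = 1 + 8 * r ^ 2 := sq_sqrt (by positivity)
  have hs1 : 1 < √(1 + 8 * r ^ 2) := by
    rw [lt_sqrt (by norm_num)]
    nlinarith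
  have hs2 : √(1 + 8 * r ^ 2) < 1 + 4 * r := by
    rw [sqrt_lt' (by linarith)]
    nlinarith
  have hl : -1 < (1 - √(1 + 8 * r ^ 2)) / (4 * r) := by
    rw [lt_div_iff₀ (by positivity)]
    linarith
  have hu : (1 - √(1 + 8 * r ^ 2)) / (4 * r) < 0 :=
    div_neg_of_neg_of_pos (by linarith) (by positivity)
  rw [φc, cos_arccos hl.le (by linarith)]
  refine ⟨?_, hl, hu⟩
  generalize √(1 + 8 * r ^ 2) = s at hs
  field_simp
  linear_combination 2 * hs

lemma R_φc {r : ℝ} (hr : 0 < r) (hr1 : r < 1) : R r (φc r) = 2 * π - φc r := by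
  obtain ⟨hq, hl, hu⟩ := cos_φc_spec hr hr1
  have hsq := sin_sq_add_cos_sq (φc r)
  have h1 := one_sub_mul_cos_pos hr hr1 (φc r)
  have hs0 : 0 ≤ sin (φc r) := sin_nonneg_of_nonneg_of_le_pi (arccos_nonneg _) (arccos_le_pi _)
  have hs : 0 < sin (φc r) := hs0.lt_of_ne' fun h => by
    rw [h] at hsq
    nlinarith
  have hpos : 0 < φc r := (arccos_nonneg _).lt_of_ne' fun h => by
    change φc r = 0 at h
    simp [h] at hs
  have hpi : φc r < π := (arccos_le_pi _).lt_of_ne fun h => by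
    change φc r = π at h
    simp [h] at hs
  have ht : r * sin (φc r) / (1 - r * cos (φc r)) = tan (φc r - π / 2) := by
    rw [tan_eq_sin_div_cos, sin_sub_pi_div_two, cos_sub_pi_div_two]
    field_simp
    linear_combination r * hsq - hq
  rw [R, ht, arctan_tan (by linarith) (by linarith)]
  ring

lemma R_two_pi_sub_φc {r : ℝ} (hr : 0 < r) (hr1 : r < 1) :
    R r (2 * π - φc r) = φc r + 2 * π := by
  have h := R_add_nat_mul_two_pi r (-φc r) 1
  rw [R_neg, R_φc hr hr1] at h
  rw [show 2 * π - φc r = -φc r + (1 : ℕ) * (2 * π) by push_cast; ring, h]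
  push_cast
  ring

lemma one_lt_reflectionDeriv_φc {r : ℝ} (hr : 0 < r) (hr1 : r < 1) :
    1 < reflectionDeriv r (φc r) := by
  obtain ⟨-, -, hu⟩ := cos_φc_spec hr hr1
  rw [reflectionDeriv, one_lt_div (by nlinarith)]
  nlinarith

theorem stmt_18 (r : ℝ) (hr : 0 < r) (hr1 : r ≤ 1 / 3) :
    ((∀ m : ℕ, yc r (2 * m + 1) 0 = 0) ∧
      Tendsto (fun m : ℕ => xc r (2 * m + 1) 0) atTop (nhds (-1))) ∧
    ((∀ m : ℕ, yc r (2 * m + 1) π = 0) ∧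
      Tendsto (fun m : ℕ => xc r (2 * m + 1) π) atTop (nhds 1)) ∧
    ((∀ m : ℕ, xc r (2 * m + 1) (φc r) = cos (φc r)) ∧
      Tendsto (fun m : ℕ => yc r (2 * m + 1) (φc r)) atTop (nhds (sin (φc r)))) := by
  have hr' : r < 1 := by linarith
  have hD := abs_reflectionDeriv_zero_mul_pi_lt_one hr hr1
  have hπ0 : R r π = 0 + 2 * π := by rw [R_pi, zero_add]
  refine ⟨⟨fun m => ?_, ?_⟩, ⟨fun m => ?_, ?_⟩, ?_⟩
  · simp [yc_odd_of_two_cycle hr hr' (R_zero r) hπ0]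
  · simpa using tendsto_xc_odd_of_two_cycle hr hr' (R_zero r) hπ0 hD
  · simp [yc_odd_of_two_cycle hr hr' (R_pi r) (R_two_pi r)]
  · have h2 : reflectionDeriv r (2 * π) = reflectionDeriv r 0 := by simp [reflectionDeriv]
    simpa using tendsto_xc_odd_of_two_cycle hr hr' (R_pi r) (R_two_pi r)
      (by rwa [h2, mul_comm])
  have hc := R_φc hr hr'
  have hc' := R_two_pi_sub_φc hr hr'
  have hlt := one_lt_reflectionDeriv_φc hr hr'
  have hD2 : reflectionDeriv r (2 * π - φc r) = reflectionDeriv r (φc r) := by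
    simp only [reflectionDeriv, cos_two_pi_sub]
  have hpos (m : ℕ) :
      0 < 1 + reflectionDeriv r (φc r) ^ (m + 1) * reflectionDeriv r (φc r) ^ m := by
    have : 0 < reflectionDeriv r (φc r) := by linarith
    positivity
  refine ⟨fun m => ?_, ?_⟩
  · rw [xc_odd_of_two_cycle hr hr' hc hc', hD2, cos_two_pi_sub, div_eq_iff (hpos m).ne']
    ring
  · have ht : Tendsto (fun m : ℕ =>
        1 + reflectionDeriv r (φc r) ^ (m + 1) * reflectionDeriv r (φc r) ^ m) atTop atTop := by
      have hp := tendsto_pow_atTop_atTop_of_one_lt hlt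
      exact tendsto_atTop_add_const_left _ _
        ((hp.comp (tendsto_add_atTop_nat 1)).atTop_mul_atTop₀ hp)
    have h := (ht.inv_tendsto_atTop.const_mul (2 * sin (φc r))).const_sub (sin (φc r))
    rw [mul_zero, sub_zero] at h
    refine h.congr fun m => ?_
    have := (hpos m).ne'
    rw [yc_odd_of_two_cycle hr hr' hc hc', hD2, sin_two_pi_sub, Pi.inv_apply]
    field_simp
    ring
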